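/- arXiv:2101.02448 — 3 statements merged into one kernel-verified Lean document; each statement's English description precedes it below -/
import Mathlib

section
/- Let k be a field of characteristic 0, U a finite subset of ℤ², and L a line in ℝ² with #(L ∩ U) = n ≥ 1. Let k⟨U⟩ denote the k-span of the monomials v^α w^β with (α,β) ∈ U inside k[v^{±1}, w^{±1}], and U' = U \ (L ∩ U). Then there is an isomorphism of k-vector spaces k⟨U⟩ ∩ (v-1, w-1)^n ≅ k⟨U'⟩ ∩ (v-1, w-1)^{n-1}. -/
/-- The monomial `v` in `k[v^{±1}, w^{±1}] = k[ℤ × ℤ]`. -/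
noncomputable def V (k : Type*) [Field k] : AddMonoidAlgebra k (ℤ × ℤ) :=
  AddMonoidAlgebra.single (1, 0) 1

/-- The monomial `w`. -/
noncomputable def W (k : Type*) [Field k] : AddMonoidAlgebra k (ℤ × ℤ) :=
  AddMonoidAlgebra.single (0, 1) 1

/-- The natural embedding of `ℤ²` into `ℝ²`. -/
noncomputable def emb : ℤ × ℤ → ℝ × ℝ := fun p => ((p.1 : ℝ), (p.2 : ℝ))

/-- For a subset `U` of `ℤ²`, the `k`-span of the monomials `v^α w^β`,
`(α, β) ∈ U`, inside `k[v^{±1}, w^{±1}]`. -/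
noncomputable def kspan (k : Type*) [Field k] (U : Set (ℤ × ℤ)) :
    Submodule k (AddMonoidAlgebra k (ℤ × ℤ)) :=
  Submodule.span k
    ((fun p : ℤ × ℤ => (AddMonoidAlgebra.single p 1 : AddMonoidAlgebra k (ℤ × ℤ))) '' U)

namespace SpanIso

open AddMonoidAlgebra

variable {k : Type*} [Field k]

/-- multiply the coefficient at `p` by `φ p`. -/
noncomputable def T (φ : ℤ × ℤ → k) :
    AddMonoidAlgebra k (ℤ × ℤ) →ₗ[k] AddMonoidAlgebra k (ℤ × ℤ) where
  toFun f := AddMonoidAlgebra.ofCoeff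
    (Finsupp.onFinset f.coeff.support (fun p => φ p * f.coeff p) (by
      intro p hp
      rw [Finsupp.mem_support_iff]
      exact right_ne_zero_of_mul hp))
  map_add' f g := by
    apply AddMonoidAlgebra.ext
    ext p
    simp [mul_add]
  map_smul' c f := by
    apply AddMonoidAlgebra.ext
    ext p
    simp [mul_left_comm]

@[simp] lemma T_coeff (φ : ℤ × ℤ → k) (f : AddMonoidAlgebra k (ℤ × ℤ)) (p : ℤ × ℤ) :
    (T φ f).coeff p = φ p * f.coeff p := rfl

@[simp] lemma T_single (φ : ℤ × ℤ → k) (p : ℤ × ℤ) (c : k) :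
    T φ (single p c) = single p (φ p * c) := by
  apply AddMonoidAlgebra.ext
  ext q
  by_cases h : p = q
  · subst h; simp
  · simp [Finsupp.single_apply, h]

lemma T_T (φ ψ : ℤ × ℤ → k) (f : AddMonoidAlgebra k (ℤ × ℤ)) :
    T φ (T ψ f) = T (φ * ψ) f := by
  apply AddMonoidAlgebra.ext
  ext q
  simp [mul_assoc]

lemma T_add (φ ψ : ℤ × ℤ → k) (f : AddMonoidAlgebra k (ℤ × ℤ)) :
    T (φ + ψ) f = T φ f + T ψ f := by
  apply AddMonoidAlgebra.ext
  ext q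
  simp [add_mul]

lemma T_smul (c : k) (φ : ℤ × ℤ → k) (f : AddMonoidAlgebra k (ℤ × ℤ)) :
    T (c • φ) f = c • T φ f := by
  apply AddMonoidAlgebra.ext
  ext q
  simp [mul_assoc]

lemma T_one (f : AddMonoidAlgebra k (ℤ × ℤ)) : T 1 f = f := by
  apply AddMonoidAlgebra.ext
  ext q
  simp

lemma T_mul (φ : ℤ × ℤ → k) (hφ : ∀ p q, φ (p + q) = φ p + φ q)
    (f g : AddMonoidAlgebra k (ℤ × ℤ)) : T φ (f * g) = T φ f * g + f * T φ g := by
  induction f using AddMonoidAlgebra.induction_linear with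
  | zero => simp
  | add f₁ f₂ h₁ h₂ => simp only [add_mul, map_add, h₁, h₂]; ring
  | single p c =>
    induction g using AddMonoidAlgebra.induction_linear with
    | zero => simp
    | add f₁ f₂ h₁ h₂ => simp only [mul_add, map_add, h₁, h₂]; ring
    | single q d =>
      simp only [AddMonoidAlgebra.single_mul_single, T_single, ← AddMonoidAlgebra.single_add, hφ]
      congr 1; ring

/-- augmentation -/
noncomputable def aug : AddMonoidAlgebra k (ℤ × ℤ) →ₗ[k] k :=
  (Finsupp.linearCombination k (fun _ : ℤ × ℤ => (1 : k))) ∘ₗ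
    (AddMonoidAlgebra.coeffLinearEquiv k).toLinearMap

@[simp] lemma aug_single (p : ℤ × ℤ) (c : k) : aug (single p c) = c := by
  simp [aug]

lemma aug_mul (f g : AddMonoidAlgebra k (ℤ × ℤ)) : aug (f * g) = aug f * aug g := by
  induction f using AddMonoidAlgebra.induction_linear with
  | zero => simp
  | add f₁ f₂ h₁ h₂ => simp only [add_mul, map_add, h₁, h₂]
  | single p c =>
    induction g using AddMonoidAlgebra.induction_linear with
    | zero => simp
    | add f₁ f₂ h₁ h₂ => simp only [mul_add, map_add, h₁, h₂]
    | single q d => simp [AddMonoidAlgebra.single_mul_single]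

lemma aug_eq_sum (S : Finset (ℤ × ℤ)) (f : AddMonoidAlgebra k (ℤ × ℤ))
    (hf : ∀ p ∉ S, f.coeff p = 0) : aug f = ∑ p ∈ S, f.coeff p := by
  simp only [aug, LinearMap.comp_apply, Finsupp.linearCombination_apply]
  rw [Finsupp.sum_of_support_subset (s := S)]
  · simp
  · intro p hp
    by_contra h
    exact (Finsupp.mem_support_iff.1 hp) (hf p h)
  · simp

variable (k) in
/-- the ideal -/
noncomputable abbrev P : Ideal (AddMonoidAlgebra k (ℤ × ℤ)) := Ideal.span {V k - 1, W k - 1}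

lemma single_sub_one_mem (p : ℤ × ℤ) : (single p 1 - 1 : AddMonoidAlgebra k (ℤ × ℤ)) ∈ P k := by
  let H : AddSubgroup (ℤ × ℤ) :=
    { carrier := {p | (single p 1 - 1 : AddMonoidAlgebra k (ℤ × ℤ)) ∈ P k}
      zero_mem' := by
        simp [AddMonoidAlgebra.one_def]
      add_mem' := by
        intro a b ha hb
        have : (single (a + b) 1 - 1 : AddMonoidAlgebra k (ℤ × ℤ)) =
          single a 1 * (single b 1 - 1) + (single a 1 - 1) := by
          simp [mul_sub, AddMonoidAlgebra.single_mul_single]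
        simp only [Set.mem_ofPred_eq] at *
        rw [this]
        exact (P k).add_mem ((P k).mul_mem_left _ hb) ha
      neg_mem' := by
        intro a ha
        have : (single (-a) 1 - 1 : AddMonoidAlgebra k (ℤ × ℤ)) =
          - single (-a) 1 * (single a 1 - 1) := by
          simp [mul_sub, AddMonoidAlgebra.single_mul_single, AddMonoidAlgebra.one_def]
          try abel
        simp only [Set.mem_ofPred_eq] at *
        rw [this]
        exact (P k).mul_mem_left _ ha }
  have h1 : ((1, 0) : ℤ × ℤ) ∈ H := Ideal.subset_span (by simp [V])
  have h2 : ((0, 1) : ℤ × ℤ) ∈ H := Ideal.subset_span (by simp [W])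
  have h3 : p = p.1 • ((1, 0) : ℤ × ℤ) + p.2 • ((0, 1) : ℤ × ℤ) := by
    ext <;> simp
  have : p ∈ H := by
    rw [h3]
    exact H.add_mem (H.zsmul_mem h1 _) (H.zsmul_mem h2 _)
  exact this

lemma mem_P_iff (f : AddMonoidAlgebra k (ℤ × ℤ)) : f ∈ P k ↔ aug f = 0 := by
  constructor
  · intro h
    rw [Ideal.mem_span_pair] at h
    obtain ⟨a, b, rfl⟩ := h
    simp [aug_mul, V, W, AddMonoidAlgebra.one_def]
  · intro h
    have key : f - single 0 (aug f) ∈ P k := by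
      clear h
      induction f using AddMonoidAlgebra.induction_linear with
      | zero => simp
      | add f₁ f₂ h₁ h₂ =>
        have := (P k).add_mem h₁ h₂
        convert this using 1
        rw [map_add, AddMonoidAlgebra.single_add]; ring
      | single p c =>
        have := (P k).mul_mem_left (single 0 c) (single_sub_one_mem p)
        convert this using 1
        simp [mul_sub, AddMonoidAlgebra.single_mul_single]
    simpa [h] using key

lemma T_mem (φ : ℤ × ℤ → k) (hφ : ∀ p q, φ (p + q) = φ p + φ q) (n : ℕ)
    (f : AddMonoidAlgebra k (ℤ × ℤ)) (hf : f ∈ P k ^ (n + 1)) : T φ f ∈ P k ^ n := by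
  induction n generalizing f with
  | zero => simp
  | succ n ih =>
    rw [pow_succ] at hf
    refine Submodule.mul_induction_on hf ?_ ?_
    · intro a ha b hb
      rw [T_mul φ hφ]
      refine Ideal.add_mem _ ?_ (Ideal.mul_mem_right _ _ ha)
      rw [pow_succ]
      exact Ideal.mul_mem_mul (ih a ha) hb
    · intro a b ha hb
      rw [map_add]; exact Ideal.add_mem _ ha hb

/-- coordinates -/
def x1 : ℤ × ℤ → k := fun p => (p.1 : k)
/-- coordinates -/
def x2 : ℤ × ℤ → k := fun p => (p.2 : k)

lemma x1_add (p q : ℤ × ℤ) : (x1 (p + q) : k) = x1 p + x1 q := by simp [x1]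
lemma x2_add (p q : ℤ × ℤ) : (x2 (p + q) : k) = x2 p + x2 q := by simp [x2]

/-- Euler operator -/
noncomputable def E (f : AddMonoidAlgebra k (ℤ × ℤ)) : AddMonoidAlgebra k (ℤ × ℤ) :=
  (V k - 1) * single (-1, 0) 1 * T x1 f + (W k - 1) * single (0, -1) 1 * T x2 f

lemma E_add (f g : AddMonoidAlgebra k (ℤ × ℤ)) : E (f + g) = E f + E g := by
  simp only [E, map_add]; ring

lemma E_mul (f g : AddMonoidAlgebra k (ℤ × ℤ)) : E (f * g) = E f * g + f * E g := by
  simp only [E, T_mul _ x1_add, T_mul _ x2_add]; ring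

lemma V_mem : V k - 1 ∈ P k := Ideal.subset_span (by simp)
lemma W_mem : W k - 1 ∈ P k := Ideal.subset_span (by simp)

lemma E_mem (f : AddMonoidAlgebra k (ℤ × ℤ)) (n : ℕ) (h1 : T x1 f ∈ P k ^ n)
    (h2 : T x2 f ∈ P k ^ n) : E f ∈ P k ^ (n + 1) := by
  rw [pow_succ']
  exact Ideal.add_mem _ (Ideal.mul_mem_mul (Ideal.mul_mem_right _ _ V_mem) h1)
    (Ideal.mul_mem_mul (Ideal.mul_mem_right _ _ W_mem) h2)

lemma E_V : E (V k - 1) = V k - 1 := by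
  have e1 : (V k : AddMonoidAlgebra k (ℤ × ℤ)) * single (-1, 0) 1 = 1 := by
    simp [V, AddMonoidAlgebra.single_mul_single, AddMonoidAlgebra.one_def]
    rfl
  have e2 : T x1 (V k - 1) = V k := by simp [V, AddMonoidAlgebra.one_def, x1]
  have e3 : T x2 (V k - 1) = 0 := by simp [V, AddMonoidAlgebra.one_def, x2]
  rw [E, e2, e3]
  linear_combination (V k - 1) * e1

lemma E_W : E (W k - 1) = W k - 1 := by
  have e1 : (W k : AddMonoidAlgebra k (ℤ × ℤ)) * single (0, -1) 1 = 1 := by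
    simp [W, AddMonoidAlgebra.single_mul_single, AddMonoidAlgebra.one_def]
    rfl
  have e2 : T x2 (W k - 1) = W k := by simp [W, AddMonoidAlgebra.one_def, x2]
  have e3 : T x1 (W k - 1) = 0 := by simp [W, AddMonoidAlgebra.one_def, x1]
  rw [E, e2, e3]
  linear_combination (W k - 1) * e1

lemma E_sub_mem_one (f : AddMonoidAlgebra k (ℤ × ℤ)) (hf : f ∈ P k) : E f - f ∈ P k ^ 2 := by
  obtain ⟨a, b, rfl⟩ := Ideal.mem_span_pair.1 hf
  have h : ∀ c : AddMonoidAlgebra k (ℤ × ℤ), E c ∈ P k := fun c => by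
    have := E_mem c 0 (by simp) (by simp)
    simpa using this
  have : E (a * (V k - 1) + b * (W k - 1)) - (a * (V k - 1) + b * (W k - 1)) =
    E a * (V k - 1) + E b * (W k - 1) := by
    rw [E_add, E_mul, E_mul, E_V, E_W]; ring
  rw [this, pow_two]
  exact Ideal.add_mem _ (Ideal.mul_mem_mul (h a) V_mem) (Ideal.mul_mem_mul (h b) W_mem)

lemma E_sub_mem (n : ℕ) (f : AddMonoidAlgebra k (ℤ × ℤ)) (hf : f ∈ P k ^ n) :
    E f - (n : AddMonoidAlgebra k (ℤ × ℤ)) * f ∈ P k ^ (n + 1) := by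
  induction n generalizing f with
  | zero => simpa using E_mem f 0 (by simp) (by simp)
  | succ n ih =>
    rw [pow_succ] at hf
    refine Submodule.mul_induction_on hf ?_ ?_
    · intro a ha b hb
      have : E (a * b) - ((n + 1 : ℕ) : AddMonoidAlgebra k (ℤ × ℤ)) * (a * b) =
        (E a - (n : AddMonoidAlgebra k (ℤ × ℤ)) * a) * b + a * (E b - b) := by
        rw [E_mul]; push_cast; ring
      rw [this]
      refine Ideal.add_mem _ ?_ ?_
      · rw [pow_succ]; exact Ideal.mul_mem_mul (ih a ha) hb
      · rw [add_assoc, pow_add]; exact Ideal.mul_mem_mul ha (E_sub_mem_one b hb)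
    · intro a b ha hb
      convert Ideal.add_mem _ ha hb using 1
      rw [E_add]; ring

lemma smul_mem_pow {I : Ideal (AddMonoidAlgebra k (ℤ × ℤ))} (c : k)
    {f : AddMonoidAlgebra k (ℤ × ℤ)} (hf : f ∈ I) : c • f ∈ I := by
  exact Submodule.smul_of_tower_mem I c hf

lemma mem_pow_succ [CharZero k] (n : ℕ) (f : AddMonoidAlgebra k (ℤ × ℤ)) (hf : f ∈ P k)
    (h1 : T x1 f ∈ P k ^ n) (h2 : T x2 f ∈ P k ^ n) : f ∈ P k ^ (n + 1) := by
  induction n with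
  | zero => simpa using hf
  | succ n ih =>
    have h := ih (Ideal.pow_le_pow_right (Nat.le_succ n) h1)
      (Ideal.pow_le_pow_right (Nat.le_succ n) h2)
    have h3 := E_sub_mem (n + 1) f h
    have h4 := E_mem f (n + 1) h1 h2
    have h5 := Ideal.sub_mem _ h4 h3
    rw [sub_sub_cancel] at h5
    have h6 := smul_mem_pow ((n + 1 : ℕ) : k)⁻¹ h5
    have h7 : ((n + 1 : ℕ) : k)⁻¹ • (((n + 1 : ℕ) : AddMonoidAlgebra k (ℤ × ℤ)) * f) = f := by
      rw [← nsmul_eq_mul, ← Nat.cast_smul_eq_nsmul k, smul_smul, inv_mul_cancel₀, one_smul]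
      exact Nat.cast_ne_zero.2 (Nat.succ_ne_zero n)
    rwa [h7] at h6

/-- affine function -/
def ell (a b c : ℤ) : ℤ × ℤ → k := fun p => ((a * p.1 + b * p.2 - c : ℤ) : k)

lemma ell_eq (a b c : ℤ) : (ell a b c : ℤ × ℤ → k) = ell a b 0 + (-(c : k)) • 1 := by
  funext p; simp [ell]; ring

lemma ell_add (a b : ℤ) (p q : ℤ × ℤ) :
    (ell a b 0 (p + q) : k) = ell a b 0 p + ell a b 0 q := by
  simp [ell]; ring

lemma T_ell_mem (a b c : ℤ) (n : ℕ)
    (f : AddMonoidAlgebra k (ℤ × ℤ)) (hf : f ∈ P k ^ (n + 1)) : T (ell a b c) f ∈ P k ^ n := by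
  rw [ell_eq, T_add, T_smul, T_one]
  exact Ideal.add_mem _ (T_mem _ (ell_add a b) n f hf)
    (smul_mem_pow _ (Ideal.pow_le_pow_right (Nat.le_succ n) hf))

lemma T_pow_mem (a b : ℤ) (n i : ℕ) 
    (f : AddMonoidAlgebra k (ℤ × ℤ)) (hf : f ∈ P k ^ (n + i)) :
    T ((ell a b 0) ^ i) f ∈ P k ^ n := by
  induction i generalizing f with
  | zero => simpa [T_one] using hf
  | succ i ih =>
    rw [pow_succ, ← T_T]
    exact ih _ (T_mem _ (ell_add a b) _ f hf)

lemma key [CharZero k] (a b c : ℤ) (hab : a ≠ 0 ∨ b ≠ 0) (n : ℕ)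
    (f : AddMonoidAlgebra k (ℤ × ℤ)) (h1 : T (ell a b c) f ∈ P k ^ n)
    (h2 : ∀ i ≤ n, aug (T ((ell (-b) a 0) ^ i) f) = 0) : f ∈ P k ^ (n + 1) := by
  induction n generalizing f with
  | zero => simpa [mem_P_iff, T_one] using h2 0 le_rfl
  | succ n ih =>
    have g1 : f ∈ P k ^ (n + 1) :=
      ih f (Ideal.pow_le_pow_right (Nat.le_succ n) h1) (fun i hi => h2 i (by omega))
    have g2 : T (ell (-b) a 0) f ∈ P k ^ (n + 1) := by
      apply ih
      · rw [T_T, mul_comm, ← T_T]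
        exact T_mem _ (ell_add _ _) n _ h1
      · intro i hi
        rw [T_T, ← pow_succ]
        exact h2 _ (by omega)
    have g3 : T (ell a b 0) f ∈ P k ^ (n + 1) := by
      have : (ell a b 0 : ℤ × ℤ → k) = ell a b c + (c : k) • 1 := by
        rw [ell_eq a b c]; funext p; simp
      rw [this, T_add, T_smul, T_one]
      exact Ideal.add_mem _ h1 (smul_mem_pow _ g1)
    have hd : ((a : k) ^ 2 + (b : k) ^ 2) ≠ 0 := by
      have : a ^ 2 + b ^ 2 ≠ 0 := by
        rcases hab with h | h
        · positivity
        · positivity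
      exact_mod_cast this
    have hx1 : (x1 : ℤ × ℤ → k) = ((a : k) ^ 2 + (b : k) ^ 2)⁻¹ •
        ((a : k) • ell a b 0 + (-(b : k)) • ell (-b) a 0) := by
      funext p; simp [x1, ell]; field_simp; ring
    have hx2 : (x2 : ℤ × ℤ → k) = ((a : k) ^ 2 + (b : k) ^ 2)⁻¹ •
        ((b : k) • ell a b 0 + (a : k) • ell (-b) a 0) := by
      funext p; simp [x2, ell]; field_simp; ring
    apply mem_pow_succ
    · simpa using Ideal.pow_le_pow_right (show 1 ≤ n + 1 by omega) g1
    · rw [hx1, T_smul, T_add, T_smul, T_smul]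
      exact smul_mem_pow _ (Ideal.add_mem _ (smul_mem_pow _ g3) (smul_mem_pow _ g2))
    · rw [hx2, T_smul, T_add, T_smul, T_smul]
      exact smul_mem_pow _ (Ideal.add_mem _ (smul_mem_pow _ g3) (smul_mem_pow _ g2))

lemma vander_inj (n : ℕ) (S : Finset (ℤ × ℤ)) (hS : S.card = n) (e : ℤ × ℤ → k)
    (he : Set.InjOn e S) (h : AddMonoidAlgebra k (ℤ × ℤ)) (hh : ∀ p ∉ S, h.coeff p = 0)
    (h0 : ∀ i < n, aug (T (e ^ i) h) = 0) : h = 0 := by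
  let σ : S ≃ Fin n := S.equivFinOfCardEq hS
  have hinj : Function.Injective (fun j : Fin n => e (σ.symm j)) := by
    intro i j hij
    exact σ.symm.injective (Subtype.ext (he (σ.symm i).2 (σ.symm j).2 hij))
  have := Matrix.eq_zero_of_forall_pow_sum_mul_pow_eq_zero
    (v := fun j : Fin n => h.coeff (σ.symm j)) hinj (by
      intro i
      have := h0 i i.2
      rw [aug_eq_sum S _ (by intro p hp; simp [hh p hp]), ← Finset.sum_coe_sort,
        ← σ.symm.sum_comp] at this
      rw [← this]
      refine Finset.sum_congr rfl fun j _ => ?_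
      simp [mul_comm])
  apply AddMonoidAlgebra.ext
  ext p
  by_cases hp : p ∈ S
  · have := congrFun this (σ ⟨p, hp⟩)
    simpa using this
  · simp [hh p hp]

lemma vander_surj (n : ℕ) (S : Finset (ℤ × ℤ)) (hS : S.card = n) (e : ℤ × ℤ → k)
    (he : Set.InjOn e S) (m : ℕ → k) : 
    ∃ h : AddMonoidAlgebra k (ℤ × ℤ), (∀ p ∉ S, h.coeff p = 0) ∧ 
    ∀ i < n, aug (T (e ^ i) h) = m i := by
  let σ : S ≃ Fin n := S.equivFinOfCardEq hS
  have hinj : Function.Injective (fun j : Fin n => e (σ.symm j)) := by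
    intro i j hij
    exact σ.symm.injective (Subtype.ext (he (σ.symm i).2 (σ.symm j).2 hij))
  have hu : IsUnit (Matrix.vandermonde (fun j : Fin n => e (σ.symm j))) := by
    rw [Matrix.isUnit_iff_isUnit_det, isUnit_iff_ne_zero]
    exact Matrix.det_vandermonde_ne_zero_iff.2 hinj
  obtain ⟨c, hc⟩ := Matrix.vecMul_surjective_iff_isUnit.2 hu (fun i : Fin n => m i)
  refine ⟨∑ j : Fin n, single (σ.symm j : ℤ × ℤ) (c j), ?_, ?_⟩
  · intro p hp
    rw [AddMonoidAlgebra.coeff_sum, Finsupp.finsetSum_apply]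
    refine Finset.sum_eq_zero fun j _ => ?_
    rw [AddMonoidAlgebra.coeff_single, Finsupp.single_apply, if_neg]
    rintro rfl
    exact hp (σ.symm j).2
  · intro i hi
    have := congrFun hc ⟨i, hi⟩
    simp only at this
    rw [← this, map_sum, map_sum]
    simp only [Matrix.vecMul, dotProduct, Matrix.vandermonde_apply, T_single, aug_single]
    refine Finset.sum_congr rfl fun j _ => ?_
    simp [mul_comm]

lemma mem_kspan (U : Set (ℤ × ℤ)) (f : AddMonoidAlgebra k (ℤ × ℤ)) :
    f ∈ kspan k U ↔ ∀ p ∉ U, f.coeff p = 0 := by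
  constructor
  · intro hf p hp
    induction hf using Submodule.span_induction with
    | mem x hx =>
      obtain ⟨q, hq, rfl⟩ := hx
      simp only [AddMonoidAlgebra.coeff_single, Finsupp.single_apply]
      rw [if_neg]
      rintro rfl
      exact hp hq
    | zero => simp
    | add x y _ _ hx hy => simp [hx, hy]
    | smul c x _ hx => simp [hx]
  · intro hf
    rw [← AddMonoidAlgebra.sum_coeff_single f]
    refine Submodule.sum_mem _ fun p hp => ?_
    have : (single p (f.coeff p) : AddMonoidAlgebra k (ℤ × ℤ)) = f.coeff p • single p 1 := by simp
    rw [this]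
    refine Submodule.smul_mem _ _ (Submodule.subset_span ⟨p, ?_, rfl⟩)
    by_contra h
    exact (Finsupp.mem_support_iff.1 hp) (hf p h)

lemma int_line (U : Set (ℤ × ℤ)) (hU : U.Finite) (L : Set (ℝ × ℝ))
    (hL : ∃ a b c : ℝ, (a, b) ≠ (0, 0) ∧ L = {x : ℝ × ℝ | a * x.1 + b * x.2 = c})
    (hne : (U ∩ {p : ℤ × ℤ | emb p ∈ L}).Nonempty) :
    ∃ a b c : ℤ, (a ≠ 0 ∨ b ≠ 0) ∧ ∀ p ∈ U, (emb p ∈ L ↔ a * p.1 + b * p.2 = c) := by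
  obtain ⟨a, b, c, hab, rfl⟩ := hL
  obtain ⟨p, hpU, hp⟩ := hne
  simp only [emb, Set.mem_ofPred_eq] at hp ⊢
  by_cases h : ∃ q ∈ U, q ≠ p ∧ a * (q.1 : ℝ) + b * (q.2 : ℝ) = c
  · obtain ⟨q, hqU, hqp, hq⟩ := h
    have hd : p.2 - q.2 ≠ 0 ∨ q.1 - p.1 ≠ 0 := by
      by_contra! hcon
      exact hqp (Prod.ext (by omega) (by omega))
    refine ⟨p.2 - q.2, q.1 - p.1, (p.2 - q.2) * p.1 + (q.1 - p.1) * p.2, hd, ?_⟩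
    intro r _
    have hd' : ((p.2 : ℝ) - q.2 ≠ 0) ∨ ((q.1 : ℝ) - p.1 ≠ 0) := by exact_mod_cast hd
    have e1 : a * ((q.1 : ℝ) - p.1) = b * ((p.2 : ℝ) - q.2) := by linarith
    have hab' : a ≠ 0 ∨ b ≠ 0 := by
      by_contra! hcon
      exact hab (by rw [hcon.1, hcon.2])
    have goal : a * (r.1 : ℝ) + b * r.2 = c ↔
        ((p.2 : ℝ) - q.2) * r.1 + (q.1 - p.1) * r.2 = (p.2 - q.2) * p.1 + (q.1 - p.1) * p.2 := by
      constructor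
      · intro hr
        have e2 : a * ((r.1 : ℝ) - p.1) = - b * ((r.2 : ℝ) - p.2) := by linarith
        rcases hab' with h | h
        · apply mul_left_cancel₀ h
          linear_combination ((p.2 : ℝ) - q.2) * e2 + (r.2 - p.2) * e1
        · apply mul_left_cancel₀ h
          linear_combination (-(r.1 - p.1 : ℝ)) * e1 + (q.1 - p.1 : ℝ) * e2
      · intro hr
        rcases hd' with h | h
        · apply mul_left_cancel₀ h
          linear_combination a * hr - (r.2 - p.2 : ℝ) * e1 + (p.2 - q.2 : ℝ) * hp
        · apply mul_left_cancel₀ h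
          linear_combination b * hr + (r.1 - p.1 : ℝ) * e1 + (q.1 - p.1 : ℝ) * hp
    rw [goal]
    exact_mod_cast Iff.rfl
  · push Not at h
    obtain ⟨N, hN⟩ := (hU.image (fun q : ℤ × ℤ => |q.1 - p.1|)).bddAbove
    refine ⟨1, N + 1, p.1 + (N + 1) * p.2, Or.inl one_ne_zero, ?_⟩
    intro r hr
    constructor
    · intro hrl
      by_cases hrp : r = p
      · subst hrp; ring
      · exact absurd hrl (h r hr hrp)
    · intro hrl
      have hb : |r.1 - p.1| ≤ N := hN ⟨r, hr, rfl⟩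
      have e : r.1 - p.1 = (N + 1) * (p.2 - r.2) := by linarith
      have hN0 : 0 ≤ N := le_trans (abs_nonneg _) hb
      have : p.2 - r.2 = 0 := by
        by_contra h0
        have h1 : 1 ≤ |p.2 - r.2| := Int.one_le_abs h0
        rw [e, abs_mul, abs_of_nonneg (by omega : 0 ≤ N + 1)] at hb
        nlinarith
      rw [this, mul_zero] at e
      have : r = p := Prod.ext (by omega) (by omega)
      rw [this]; exact hp

end SpanIso

open SpanIso in
/-- Let `k` be a field of characteristic 0, `U ⊂ ℤ²` finite, and `L` a line in
`ℝ²` meeting `U` in exactly `n ≥ 1` points.  With `U' = U \ (L ∩ U)`, there is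
an isomorphism of `k`-vector spaces
`k⟨U⟩ ∩ (v-1, w-1)^n ≅ k⟨U'⟩ ∩ (v-1, w-1)^{n-1}`. -/
theorem span_inter_pow_iso (k : Type*) [Field k] [CharZero k]
    (U : Set (ℤ × ℤ)) (hU : U.Finite) (L : Set (ℝ × ℝ))
    (hL : ∃ a b c : ℝ, (a, b) ≠ (0, 0) ∧ L = {x : ℝ × ℝ | a * x.1 + b * x.2 = c})
    (n : ℕ) (hn : 1 ≤ n)
    (hcard : (U ∩ {p : ℤ × ℤ | emb p ∈ L}).ncard = n) :
    Nonempty (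
      ↥(kspan k U ⊓
          Submodule.restrictScalars k ((Ideal.span {V k - 1, W k - 1}) ^ n))
      ≃ₗ[k]
      ↥(kspan k (U \ {p : ℤ × ℤ | emb p ∈ L}) ⊓
          Submodule.restrictScalars k ((Ideal.span {V k - 1, W k - 1}) ^ (n - 1)))) := by
  obtain ⟨m, rfl⟩ : ∃ m, n = m + 1 := ⟨n - 1, by omega⟩
  rw [Nat.add_sub_cancel]
  obtain ⟨a, b, c, hab, hline⟩ := int_line U hU L hL
    (Set.nonempty_of_ncard_ne_zero (by omega))
  have hfin : (U ∩ {p : ℤ × ℤ | emb p ∈ L}).Finite := hU.inter_of_left _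
  set S : Finset (ℤ × ℤ) := hfin.toFinset with hSdef
  have hmemS : ∀ p, p ∈ S ↔ p ∈ U ∧ emb p ∈ L := by intro p; simp [hSdef]
  have hScard : S.card = m + 1 := by
    rw [← hcard, Set.ncard_eq_toFinset_card _ hfin]
  have hell : ∀ p ∈ U, ((ell a b c p : k) = 0 ↔ emb p ∈ L) := by
    intro p hp
    rw [hline p hp, ell, Int.cast_eq_zero, sub_eq_zero]
  have hinj : Set.InjOn (ell (-b) a 0 : ℤ × ℤ → k) S := by
    intro p hp q hq hpq
    have hp' := (hmemS p).1 hp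
    have hq' := (hmemS q).1 hq
    have e1 := (hline p hp'.1).1 hp'.2
    have e2 := (hline q hq'.1).1 hq'.2
    have e3 : -b * p.1 + a * p.2 - 0 = -b * q.1 + a * q.2 - 0 := by
      simpa only [ell, Int.cast_inj] using hpq
    have hd : a ^ 2 + b ^ 2 ≠ 0 := by
      rcases hab with h | h
      · positivity
      · positivity
    apply Prod.ext
    · apply mul_left_cancel₀ hd
      linear_combination a * e1 - a * e2 - b * e3
    · apply mul_left_cancel₀ hd
      linear_combination b * e1 - b * e2 + a * e3
  let A₁ := kspan k U ⊓ Submodule.restrictScalars k ((P k) ^ (m + 1))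
  let A₂ := kspan k (U \ {p : ℤ × ℤ | emb p ∈ L}) ⊓ Submodule.restrictScalars k ((P k) ^ m)
  have hmap : ∀ f ∈ A₁, T (ell a b c) f ∈ A₂ := by
    rintro f ⟨hf1, hf2⟩
    refine ⟨?_, T_ell_mem a b c m f hf2⟩
    rw [SetLike.mem_coe, mem_kspan] at hf1 ⊢
    intro p hp
    rw [T_coeff]
    by_cases hpU : p ∈ U
    · have hpL : emb p ∈ L := by
        by_contra h
        exact hp ⟨hpU, h⟩
      rw [(hell p hpU).2 hpL, zero_mul]
    · rw [hf1 p hpU, mul_zero]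
  refine ⟨LinearEquiv.ofBijective ((T (ell a b c)).restrict hmap : A₁ →ₗ[k] A₂) ⟨?_, ?_⟩⟩
  · rw [← LinearMap.ker_eq_bot, LinearMap.ker_eq_bot']
    rintro ⟨f, hf1, hf2⟩ h0
    have h0' : T (ell a b c) f = 0 := congrArg Subtype.val h0
    rw [SetLike.mem_coe, mem_kspan] at hf1
    apply Subtype.ext
    refine vander_inj (m + 1) S hScard (ell (-b) a 0) hinj f ?_ ?_
    · intro p hp
      by_cases hpU : p ∈ U
      · have h1 : (T (ell a b c) f).coeff p = 0 := by rw [h0']; simp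
        rw [T_coeff] at h1
        rcases mul_eq_zero.1 h1 with h | h
        · exact absurd ((hmemS p).2 ⟨hpU, (hell p hpU).1 h⟩) hp
        · exact h
      · exact hf1 p hpU
    · intro i hi
      rw [← mem_P_iff, ← pow_one (P k)]
      exact T_pow_mem _ _ 1 i f (Ideal.pow_le_pow_right (by omega) hf2)
  · rintro ⟨g, hg1, hg2⟩
    rw [SetLike.mem_coe, mem_kspan] at hg1
    let f₀ := T (ell a b c)⁻¹ g
    obtain ⟨h, hh1, hh2⟩ := vander_surj (m + 1) S hScard (ell (-b) a 0 : ℤ × ℤ → k) hinj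
      (fun i => - aug (T ((ell (-b) a 0) ^ i) f₀))
    have hT : T (ell a b c) (f₀ + h) = g := by
      apply AddMonoidAlgebra.ext
      ext p
      simp only [f₀, T_coeff, AddMonoidAlgebra.coeff_add, Finsupp.add_apply, Pi.inv_apply]
      by_cases hp : p ∈ S
      · have hp' := (hmemS p).1 hp
        rw [(hell p hp'.1).2 hp'.2, hg1 p (fun h => h.2 hp'.2), zero_mul]
      · rw [hh1 p hp, add_zero]
        by_cases hpU : p ∈ U
        · have : (ell a b c p : k) ≠ 0 := fun h0 => hp ((hmemS p).2 ⟨hpU, (hell p hpU).1 h0⟩)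
          rw [mul_inv_cancel_left₀ this]
        · rw [hg1 p (fun h => hpU h.1)]; simp
    refine ⟨⟨f₀ + h, ?_, ?_⟩, Subtype.ext hT⟩
    · rw [SetLike.mem_coe, mem_kspan]
      intro p hp
      simp only [f₀, T_coeff, AddMonoidAlgebra.coeff_add, Finsupp.add_apply]
      rw [hg1 p (fun h => hp h.1), hh1 p (fun h => hp ((hmemS p).1 h).1)]
      simp
    · refine key a b c hab m _ (by rw [hT]; exact hg2) ?_
      intro i hi
      rw [map_add, map_add, hh2 i (by omega)]
      simp
end

section
/- Let a, b, c be pairwise coprime positive integers and let 𝔭_{a,b,c} be the kernel of the k-algebra homomorphism k[x,y,z] → k[λ] sending x ↦ λ^a, y ↦ λ^b, z ↦ λ^c. Then 𝔭_{a,b,c} is a prime ideal of height 2. -/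
/-- Let `a, b, c` be pairwise coprime positive integers and `𝔭_{a,b,c}` the
kernel of the `k`-algebra map `k[x,y,z] → k[λ]`, `x ↦ λ^a`, `y ↦ λ^b`,
`z ↦ λ^c`.  Then `𝔭_{a,b,c}` is a prime ideal of height 2 (the height being
expressed as the Krull dimension of the localization at the prime). -/
theorem ker_monomial_curve_prime_height_two (k : Type*) [Field k]
    (a b c : ℕ) (ha : 0 < a) (hb : 0 < b) (hc : 0 < c)
    (hab : Nat.Coprime a b) (hbc : Nat.Coprime b c) (hac : Nat.Coprime a c)
    (P : Ideal (MvPolynomial (Fin 3) k))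
    (hP : P = RingHom.ker (MvPolynomial.aeval
      ![Polynomial.X ^ a, Polynomial.X ^ b, Polynomial.X ^ c] :
        MvPolynomial (Fin 3) k →ₐ[k] Polynomial k)) :
    ∃ hp : P.IsPrime,
      ringKrullDim (Localization (@Ideal.primeCompl _ _ P hp)) = 2 := by
  have hp : P.IsPrime := by rw [hP]; exact RingHom.ker_isPrime _
  refine ⟨hp, ?_⟩
  rw [IsLocalization.AtPrime.ringKrullDim_eq_height P]
  -- upper bound: `P` is strictly contained in the maximal ideal at the origin
  let ε : MvPolynomial (Fin 3) k →ₐ[k] k := MvPolynomial.aeval ![0, 0, 0]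
  have hεp : (RingHom.ker ε).IsPrime := RingHom.ker_isPrime _
  have hε : ε = (Polynomial.aeval (0 : k)).comp (MvPolynomial.aeval
      ![Polynomial.X ^ a, Polynomial.X ^ b, Polynomial.X ^ c] :
        MvPolynomial (Fin 3) k →ₐ[k] Polynomial k) := by
    apply MvPolynomial.algHom_ext
    intro i
    fin_cases i <;> simp [ε, ha.ne', hb.ne', hc.ne']
  have hPM : P < RingHom.ker ε := by
    refine lt_of_le_of_ne ?_ ?_
    · intro f hf
      rw [hP, RingHom.mem_ker] at hf
      rw [RingHom.mem_ker, hε, AlgHom.comp_apply, hf, map_zero]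
    · intro h
      have hx : (MvPolynomial.X 0 : MvPolynomial (Fin 3) k) ∈ RingHom.ker ε := by
        simp [RingHom.mem_ker, ε]
      rw [← h, hP, RingHom.mem_ker] at hx
      simp at hx
  have h1 := Ideal.height_add_one_le_of_lt_of_isPrime hPM
  have h2 := Ideal.height_le_ringKrullDim_of_isPrime (I := RingHom.ker ε)
  rw [MvPolynomial.ringKrullDim_of_isNoetherianRing, ringKrullDim_eq_zero_of_field] at h2
  have h2' : (RingHom.ker ε).height ≤ 3 := by
    have : ((RingHom.ker ε).height : WithBot ℕ∞) ≤ ((3 : ℕ∞) : WithBot ℕ∞) := by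
      simpa using h2
    exact_mod_cast this
  -- lower bound: the chain `0 < Q < P`
  let ψ : MvPolynomial (Fin 3) k →ₐ[k] Polynomial (Polynomial k) := MvPolynomial.aeval
    ![Polynomial.C (Polynomial.X ^ a), Polynomial.C (Polynomial.X ^ b), Polynomial.X]
  have hψp : (RingHom.ker ψ).IsPrime := RingHom.ker_isPrime _
  have hψ : (MvPolynomial.aeval
      ![Polynomial.X ^ a, Polynomial.X ^ b, Polynomial.X ^ c] :
        MvPolynomial (Fin 3) k →ₐ[k] Polynomial k) =
      ((Polynomial.aeval (R := Polynomial k)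
        (Polynomial.X ^ c : Polynomial k)).restrictScalars k).comp ψ := by
    apply MvPolynomial.algHom_ext
    intro i
    fin_cases i <;> simp [ψ]
  have hQP : RingHom.ker ψ < P := by
    refine lt_of_le_of_ne ?_ ?_
    · intro f hf
      rw [RingHom.mem_ker] at hf
      rw [hP, RingHom.mem_ker, hψ, AlgHom.comp_apply, hf, map_zero]
    · intro h
      have hx : (MvPolynomial.X 2 ^ a - MvPolynomial.X 0 ^ c : MvPolynomial (Fin 3) k) ∈ P := by
        rw [hP, RingHom.mem_ker]
        simp [← pow_mul, mul_comm]
      rw [← h, RingHom.mem_ker] at hx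
      refine Polynomial.X_pow_sub_C_ne_zero ha ((Polynomial.X ^ a) ^ c : Polynomial k) ?_
      simpa [ψ] using hx
  have h0Q : (⊥ : Ideal (MvPolynomial (Fin 3) k)) < RingHom.ker ψ := by
    rw [bot_lt_iff_ne_bot]
    intro h
    have hx : (MvPolynomial.X 0 ^ b - MvPolynomial.X 1 ^ a : MvPolynomial (Fin 3) k)
        ∈ RingHom.ker ψ := by
      rw [RingHom.mem_ker]
      simp [ψ, ← pow_mul, mul_comm]
    rw [h, Ideal.mem_bot] at hx
    have := congrArg (MvPolynomial.aeval (![1, 0, 0] : Fin 3 → k)) hx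
    simp [ha.ne'] at this
  have h3 := Ideal.height_add_one_le_of_lt_of_isPrime hQP
  have h4 := Ideal.height_add_one_le_of_lt_of_isPrime h0Q
  have hle : P.height ≤ 2 := by
    have h5 : P.height + 1 ≤ 2 + 1 := (h1.trans h2').trans (by norm_num)
    exact (ENat.add_le_add_iff_right (by simp)).1 h5
  have hge : 2 ≤ P.height := by
    refine le_trans ?_ h3
    have h6 : (1 : ℕ∞) ≤ (RingHom.ker ψ).height := le_trans (by simp) h4
    calc (2 : ℕ∞) = 1 + 1 := by norm_num
      _ ≤ _ := by gcongr
  rw [le_antisymm hle hge]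
  rfl
end

section
/- Let r ≥ 2 and let P be a convex lattice polygon in ℝ² with positive area strictly less than r²/2. Then, after applying a suitable affine transformation of ℝ² preserving the lattice ℤ² (composition of an element of GL(2,ℤ) and an integer translation), P is contained in the trapezoid Ω with vertices (0,0), (√2·r², 0), ((√2+1)·r², r²), (0, r²). -/
section Helpers
open MeasureTheory

/-- The linear map of the plane with matrix `[[a, b], [c, d]]`. -/
noncomputable def linTwo (a b c d : ℝ) : ℝ × ℝ →ₗ[ℝ] ℝ × ℝ :=
  Matrix.toLin (Module.Basis.finTwoProd ℝ) (Module.Basis.finTwoProd ℝ) !![a, b; c, d]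

lemma linTwo_apply (a b c d : ℝ) (z : ℝ × ℝ) :
    linTwo a b c d z = (a * z.1 + b * z.2, c * z.1 + d * z.2) := by
  unfold linTwo
  rw [Matrix.toLin_finTwoProd]
  simp

lemma linTwo_det (a b c d : ℝ) : LinearMap.det (linTwo a b c d) = a * d - b * c := by
  unfold linTwo
  rw [LinearMap.det_toLin, Matrix.det_fin_two_of]

/-- The open standard triangle of size `D`. -/
def stdTri (D : ℝ) : Set (ℝ × ℝ) := {z | 0 < z.1 ∧ 0 < z.2 ∧ z.1 + z.2 < D}

lemma volume_stdTri (D : ℝ) (hD : 0 ≤ D) : volume (stdTri D) = ENNReal.ofReal (D ^ 2 / 2) := by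
  have h1 : stdTri D = regionBetween (fun _ => (0 : ℝ)) (fun x => D - x) (Set.Ioo 0 D) := by
    ext z
    simp only [stdTri, regionBetween, Set.mem_ofPred_eq, Set.mem_Ioo]
    constructor
    · rintro ⟨h1, h2, h3⟩
      refine ⟨⟨h1, by linarith⟩, h2, by linarith⟩
    · rintro ⟨⟨h1, h2⟩, h3, h4⟩
      refine ⟨h1, h3, by linarith⟩
  have hi : IntegrableOn (fun x : ℝ => D - x) (Set.Ioo 0 D) volume :=
    ((by fun_prop : Continuous (fun x : ℝ => D - x)).integrableOn_Icc (a := 0) (b := D)).mono_set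
      Set.Ioo_subset_Icc_self
  rw [h1, Measure.volume_eq_prod, volume_regionBetween_eq_integral (by simp) hi measurableSet_Ioo]
  · congr 1
    rw [← integral_Ioc_eq_integral_Ioo, ← intervalIntegral.integral_of_le hD]
    simp only [Pi.sub_apply, sub_zero]
    rw [intervalIntegral.integral_sub (by simp) (by simp)]
    simp
    ring
  · intro x hx
    simp only [Set.mem_Ioo] at hx
    linarith [hx.2]

/-- The cross product. -/
def crs (a b : ℝ × ℝ) : ℝ := a.1 * b.2 - a.2 * b.1

/-- Open triangle with vertices `p, q, u` (positively oriented). -/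
def opTri (p q u : ℝ × ℝ) : Set (ℝ × ℝ) :=
  {z | 0 < crs (z - p) (u - p) ∧ 0 < crs (q - p) (z - p) ∧
    crs (z - p) (u - p) + crs (q - p) (z - p) < crs (q - p) (u - p)}

lemma opTri_open (p q u : ℝ × ℝ) : IsOpen (opTri p q u) := by
  have h1 : Continuous (fun z : ℝ × ℝ => crs (z - p) (u - p)) := by unfold crs; fun_prop
  have h2 : Continuous (fun z : ℝ × ℝ => crs (q - p) (z - p)) := by unfold crs; fun_prop
  exact (isOpen_lt continuous_const h1).inter
    ((isOpen_lt continuous_const h2).inter (isOpen_lt (h1.add h2) continuous_const))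

lemma volume_opTri (p q u : ℝ × ℝ) (h : 0 ≤ crs (q - p) (u - p)) :
    volume (opTri p q u) = ENNReal.ofReal (crs (q - p) (u - p) / 2) := by
  rcases h.eq_or_lt with h0 | h0
  · have : opTri p q u = ∅ := by
      ext z
      simp only [opTri, Set.mem_ofPred_eq, Set.mem_empty_iff_false, iff_false]
      rintro ⟨h1, h2, h3⟩
      linarith
    rw [this, ← h0]; simp
  · set D := crs (q - p) (u - p) with hD
    let f := linTwo (u - p).2 (-(u - p).1) (-(q - p).2) ((q - p).1)
    have hdet : LinearMap.det f = D := by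
      simp only [f, linTwo_det, hD, crs]; ring
    have e : opTri p q u = (fun z => z + (-p)) ⁻¹' (f ⁻¹' stdTri D) := by
      ext z
      simp only [opTri, stdTri, Set.mem_preimage, Set.mem_ofPred_eq, f, linTwo_apply, hD, crs,
        Prod.fst_sub, Prod.snd_sub, Prod.fst_add, Prod.snd_add, Prod.fst_neg, Prod.snd_neg]
      refine and_congr ?_ (and_congr ?_ ?_) <;> ring_nf
    rw [e, measure_preimage_add_right, Measure.addHaar_preimage_linearMap _ (by rw [hdet]; exact h0.ne'),
      volume_stdTri D h, hdet, ← ENNReal.ofReal_mul (abs_nonneg _), abs_of_pos (inv_pos.mpr h0)]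
    congr 1
    field_simp

lemma opTri_subset {P : Set (ℝ × ℝ)} (hP : Convex ℝ P) {p q u : ℝ × ℝ} (hp : p ∈ P) (hq : q ∈ P)
    (hu : u ∈ P) : opTri p q u ⊆ P := by
  rintro z ⟨h1, h2, h3⟩
  set D := crs (q - p) (u - p) with hD
  have h0 : 0 < D := by linarith
  have hz : z = (1 - crs (z - p) (u - p) / D - crs (q - p) (z - p) / D) • p
      + (crs (z - p) (u - p) / D) • q + (crs (q - p) (z - p) / D) • u := by
    have h0' := h0.ne'
    have e1 : D * z.1 = (D - crs (z - p) (u - p) - crs (q - p) (z - p)) * p.1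
      + crs (z - p) (u - p) * q.1 + crs (q - p) (z - p) * u.1 := by
      simp only [hD, crs, Prod.fst_sub, Prod.snd_sub]; ring
    have e2 : D * z.2 = (D - crs (z - p) (u - p) - crs (q - p) (z - p)) * p.2
      + crs (z - p) (u - p) * q.2 + crs (q - p) (z - p) * u.2 := by
      simp only [hD, crs, Prod.fst_sub, Prod.snd_sub]; ring
    generalize crs (z - p) (u - p) = A at *
    generalize crs (q - p) (z - p) = B at *
    clear_value D
    ext
    · simp only [Prod.fst_add, Prod.smul_fst, smul_eq_mul]
      field_simp
      linarith
    · simp only [Prod.snd_add, Prod.smul_snd, smul_eq_mul]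
      field_simp
      linarith
  have k1 := div_pos h1 h0
  have k2 := div_pos h2 h0
  have k3 : crs (z - p) (u - p) / D + crs (q - p) (z - p) / D < 1 := by
    rw [← add_div, div_lt_one h0]; exact h3
  rw [hz]
  have := hP.sum_mem (t := Finset.univ)
    (w := ![1 - crs (z - p) (u - p) / D - crs (q - p) (z - p) / D, crs (z - p) (u - p) / D,
      crs (q - p) (z - p) / D]) (z := ![p, q, u]) (by
        intro i _
        fin_cases i
        · simp; linarith
        · simp; linarith
        · simp; linarith) (by simp [Fin.sum_univ_three]; ring) (by
        intro i _
        fin_cases i <;> simpa)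
  simpa [Fin.sum_univ_three] using this

lemma two_tri {P : Set (ℝ × ℝ)} (hP : Convex ℝ P) {p q u v : ℝ × ℝ} (hp : p ∈ P) (hq : q ∈ P)
    (hu : u ∈ P) (hv : v ∈ P) (h1 : 0 ≤ crs (q - p) (u - p)) (h2 : crs (q - p) (v - p) ≤ 0) :
    ENNReal.ofReal (crs (q - p) (u - v) / 2) ≤ volume P := by
  have e2 : crs (p - q) (v - q) = - crs (q - p) (v - p) := by
    simp only [crs, Prod.fst_sub, Prod.snd_sub]; ring
  have e3 : crs (q - p) (u - v) = crs (q - p) (u - p) + crs (p - q) (v - q) := by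
    simp only [crs, Prod.fst_sub, Prod.snd_sub]; ring
  have hd : Disjoint (opTri p q u) (opTri q p v) := by
    rw [Set.disjoint_left]
    rintro z ⟨-, a, -⟩ ⟨-, b, -⟩
    have : crs (p - q) (z - q) = - crs (q - p) (z - p) := by
      simp only [crs, Prod.fst_sub, Prod.snd_sub]; ring
    linarith
  have h3 : 0 ≤ crs (p - q) (v - q) := by linarith
  rw [e3, add_div, ENNReal.ofReal_add (by linarith) (by linarith), ← volume_opTri p q u h1,
    ← volume_opTri q p v h3, ← measure_union hd (opTri_open _ _ _).measurableSet]
  exact measure_mono (Set.union_subset (opTri_subset hP hp hq hu) (opTri_subset hP hq hp hv))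

lemma crs_bound {P : Set (ℝ × ℝ)} (hP : Convex ℝ P) {p q u v : ℝ × ℝ} (hp : p ∈ P) (hq : q ∈ P)
    (hu : u ∈ P) (hv : v ∈ P) {R : ℝ} (hR : 0 < R) (hvol : volume P < ENNReal.ofReal (R / 2)) :
    crs (q - p) (u - v) < R := by
  have key : ∀ u ∈ P, ∀ v ∈ P, 0 ≤ crs (q - p) (u - p) → crs (q - p) (v - p) ≤ 0 →
      crs (q - p) (u - v) < R := by
    intro u hu v hv h1 h2
    have := (two_tri hP hp hq hu hv h1 h2).trans_lt hvol
    rw [ENNReal.ofReal_lt_ofReal_iff (by linarith)] at this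
    linarith
  have e : ∀ u v, crs (q - p) (u - v) = crs (q - p) (u - p) - crs (q - p) (v - p) := by
    intro u v
    simp only [crs, Prod.fst_sub, Prod.snd_sub]; ring
  have e0 : crs (q - p) (p - p) = 0 := by simp [crs]
  have a := e u v
  have b := e u p
  have c := e p v
  rcases le_total 0 (crs (q - p) (u - p)) with h1 | h1 <;>
    rcases le_total 0 (crs (q - p) (v - p)) with h2 | h2
  · have := key u hu p hp h1 e0.le
    linarith
  · exact key u hu v hv h1 h2
  · linarith
  · have := key p hp v hv e0.ge h2
    linarith

lemma volume_line (a b c : ℝ) (h : a ^ 2 + b ^ 2 ≠ 0) :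
    volume {z : ℝ × ℝ | a * z.1 + b * z.2 = c} = 0 := by
  have e : {z : ℝ × ℝ | a * z.1 + b * z.2 = c} = linTwo a b (-b) a ⁻¹' ({c} ×ˢ Set.univ) := by
    ext z
    simp [linTwo_apply]
  have hd : LinearMap.det (linTwo a b (-b) a) ≠ 0 := by
    rw [linTwo_det]; intro h'; apply h; linarith
  rw [e, Measure.addHaar_preimage_linearMap _ hd, Measure.volume_eq_prod, Measure.prod_prod]
  simp

lemma not_const (S : Finset (ℤ × ℤ)) (hpos : 0 < volume (convexHull ℝ (emb '' (S : Set (ℤ × ℤ)))))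
    (a b c : ℤ) (h : a ^ 2 + b ^ 2 ≠ 0) : ∃ z ∈ S, a * z.1 + b * z.2 ≠ c := by
  by_contra! hc
  have hsub : convexHull ℝ (emb '' (S : Set (ℤ × ℤ))) ⊆
      {z : ℝ × ℝ | (a : ℝ) * z.1 + b * z.2 = c} := by
    apply convexHull_min
    · rintro _ ⟨z, hz, rfl⟩
      have := hc z hz
      simp only [emb, Set.mem_ofPred_eq]
      exact_mod_cast this
    · intro x hx y hy s t hs ht hst
      simp only [Set.mem_ofPred_eq, Prod.fst_add, Prod.snd_add, Prod.smul_fst, Prod.smul_snd,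
        smul_eq_mul] at *
      have : t = 1 - s := by linarith
      subst this
      linear_combination s * hx + (1 - s) * hy
  have := measure_mono (μ := volume) hsub
  rw [volume_line _ _ _ (by exact_mod_cast h)] at this
  exact absurd hpos (not_lt.mpr this)

/-- The purely integral part of the argument. -/
lemma integer_part (S : Finset (ℤ × ℤ)) (R : ℤ)
    (hdet : ∀ p ∈ S, ∀ q ∈ S, ∀ u ∈ S, ∀ v ∈ S,
      (q.1 - p.1) * (u.2 - v.2) - (q.2 - p.2) * (u.1 - v.1) < R)
    (hnc : ∀ a b c : ℤ, a ^ 2 + b ^ 2 ≠ 0 → ∃ z ∈ S, a * z.1 + b * z.2 ≠ c) :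
    ∃ (M : Matrix (Fin 2) (Fin 2) ℤ) (t : ℤ × ℤ), IsUnit M.det ∧ ∀ z ∈ S,
      0 ≤ M 0 0 * z.1 + M 0 1 * z.2 + t.1 ∧ 0 ≤ M 1 0 * z.1 + M 1 1 * z.2 + t.2 ∧
      M 1 0 * z.1 + M 1 1 * z.2 + t.2 ≤ R ∧
      M 0 0 * z.1 + M 0 1 * z.2 + t.1 ≤ R + (M 1 0 * z.1 + M 1 1 * z.2 + t.2) := by
  obtain ⟨p, hp, -⟩ := hnc 1 0 0 (by norm_num)
  obtain ⟨q, hq, hpq⟩ := hnc 1 0 p.1 (by norm_num)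
  have hne : q.1 - p.1 ≠ 0 := by
    intro h; apply hpq; linarith
  have hRpos : 0 < R := by simpa using hdet p hp p hp p hp p hp
  -- primitive direction
  have hg : 0 < Int.gcd (q.1 - p.1) (q.2 - p.2) := Int.gcd_pos_of_ne_zero_left _ hne
  obtain ⟨d, hd0, α, β, γ, δ, hα, hβ, hbez⟩ : ∃ d : ℤ, 0 < d ∧ ∃ α β γ δ : ℤ,
      q.1 - p.1 = d * α ∧ q.2 - p.2 = d * β ∧ γ * α + δ * β = 1 := by
    obtain ⟨α, hα⟩ := Int.gcd_dvd_left (q.1 - p.1) (q.2 - p.2)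
    obtain ⟨β, hβ⟩ := Int.gcd_dvd_right (q.1 - p.1) (q.2 - p.2)
    have hb := Int.gcd_eq_gcd_ab (q.1 - p.1) (q.2 - p.2)
    have hg' : (0 : ℤ) < (Int.gcd (q.1 - p.1) (q.2 - p.2) : ℤ) := by exact_mod_cast hg
    generalize Int.gcdA (q.1 - p.1) (q.2 - p.2) = A at *
    generalize Int.gcdB (q.1 - p.1) (q.2 - p.2) = B at *
    generalize (Int.gcd (q.1 - p.1) (q.2 - p.2) : ℤ) = g at *
    refine ⟨g, hg', α, β, A, B, hα, hβ, ?_⟩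
    apply mul_left_cancel₀ hg'.ne'
    rw [hα, hβ] at hb
    linear_combination -hb
  have hαβ : β ^ 2 + α ^ 2 ≠ 0 := by
    intro h
    have h1 : β = 0 := by nlinarith [sq_nonneg β, sq_nonneg α]
    have h2 : α = 0 := by nlinarith [sq_nonneg β, sq_nonneg α]
    subst h1 h2
    simp at hbez
  let Y : ℤ × ℤ → ℤ := fun z => -β * z.1 + α * z.2
  have hS : S.Nonempty := ⟨p, hp⟩
  obtain ⟨b, hb, hbmin⟩ := S.exists_min_image Y hS
  obtain ⟨t, ht, htmax⟩ := S.exists_max_image Y hS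
  obtain ⟨o, ho, hob⟩ := hnc (-β) α (Y b) (by simpa using hαβ)
  have hH : 0 < Y t - Y b := by
    have h1 := hbmin o ho
    have h2 := htmax o ho
    have h3 : Y o ≠ Y b := hob
    omega
  have hYr : Y t - Y b < R := by
    have h1 := hdet p hp q hq t ht b hb
    have h2 : (q.1 - p.1) * (t.2 - b.2) - (q.2 - p.2) * (t.1 - b.1) = d * (Y t - Y b) := by
      rw [hα, hβ]; simp only [Y]; ring
    rw [h2] at h1
    nlinarith
  set H := Y t - Y b with hHdef
  let X0 : ℤ × ℤ → ℤ := fun z => γ * z.1 + δ * z.2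
  set k := (X0 t - X0 b) / H with hk
  let X : ℤ × ℤ → ℤ := fun z => (γ + k * β) * z.1 + (δ - k * α) * z.2
  have hX : ∀ z, X z = X0 z - k * Y z := by
    intro z; simp only [X, X0, Y]; ring
  have hw : X t - X b = (X0 t - X0 b) % H := by
    have := Int.emod_add_mul_ediv (X0 t - X0 b) H
    rw [hX, hX, ← hk] at *
    rw [hHdef] at this ⊢
    linear_combination -this
  have hw0 : 0 ≤ X t - X b := by rw [hw]; exact Int.emod_nonneg _ hH.ne'
  have hw1 : X t - X b < H := by rw [hw]; exact Int.emod_lt_of_pos _ hH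
  obtain ⟨m, hm, hmmin⟩ := S.exists_min_image X hS
  refine ⟨!![γ + k * β, δ - k * α; -β, α], (-X m, -Y b), ?_, ?_⟩
  · rw [Matrix.det_fin_two_of]
    have : (γ + k * β) * α - (δ - k * α) * -β = 1 := by linear_combination hbez
    rw [this]; exact isUnit_one
  · intro z hz
    have h1 := hmmin z hz
    have h2 := hbmin z hz
    have h3 := htmax z hz
    have h4 := hbmin m hm
    have h5 := hdet b hb t ht m hm z hz
    have h6 : (t.1 - b.1) * (m.2 - z.2) - (t.2 - b.2) * (m.1 - z.1)
        = (X t - X b) * (Y m - Y z) - H * (X m - X z) := by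
      rw [hHdef]
      simp only [X, Y]
      linear_combination (-((t.1 - b.1) * (m.2 - z.2) - (t.2 - b.2) * (m.1 - z.1))) * hbez
    rw [h6] at h5
    have h7 : X z - X m ≤ R + (Y z - Y b) := by
      have a1 : (X t - X b) * (Y z - Y m) ≤ (X t - X b) * (Y z - Y b) :=
        mul_le_mul_of_nonneg_left (by linarith) hw0
      have a2 : (X t - X b) * (Y z - Y b) ≤ H * (Y z - Y b) :=
        mul_le_mul_of_nonneg_right hw1.le (by linarith)
      by_contra! hc
      have a3 : H * (R + (Y z - Y b)) < H * (X z - X m) := mul_lt_mul_of_pos_left hc hH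
      have a4 : R ≤ H * R := by nlinarith
      linarith
    simp only [Matrix.of_apply, Matrix.cons_val_zero, Matrix.cons_val_one, Matrix.cons_val',
      Matrix.cons_val_fin_one]
    change 0 ≤ X z + -X m ∧ 0 ≤ Y z + -Y b ∧ Y z + -Y b ≤ R ∧ X z + -X m ≤ R + (Y z + -Y b)
    refine ⟨by linarith, by linarith, by linarith, by linarith⟩

lemma mem_trap (R s x y : ℝ) (hR : 0 < R) (hs : 0 < s) (hx : 0 ≤ x) (hy : 0 ≤ y) (hyR : y ≤ R)
    (hxy : x ≤ s * R + y) :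
    (x, y) ∈ convexHull ℝ {((0 : ℝ), (0 : ℝ)), (s * R, 0), ((s + 1) * R, R), (0, R)} := by
  set C := convexHull ℝ {((0 : ℝ), (0 : ℝ)), (s * R, 0), ((s + 1) * R, R), (0, R)} with hC
  have hconv : Convex ℝ C := convex_convexHull ℝ _
  have m1 : ((0 : ℝ), (0 : ℝ)) ∈ C := subset_convexHull ℝ _ (by simp)
  have m2 : (s * R, (0 : ℝ)) ∈ C := subset_convexHull ℝ _ (by simp)
  have m3 : ((s + 1) * R, R) ∈ C := subset_convexHull ℝ _ (by simp)
  have m4 : ((0 : ℝ), R) ∈ C := subset_convexHull ℝ _ (by simp)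
  have q0 : 0 ≤ y / R := by positivity
  have q1 : y / R ≤ 1 := by rw [div_le_one hR]; exact hyR
  have l : ((0 : ℝ), y) ∈ C := by
    have := hconv m1 m4 (a := 1 - y / R) (b := y / R) (by linarith) q0 (by ring)
    convert this using 1
    ext <;> simp
    field_simp
  have rr : (s * R + y, y) ∈ C := by
    have := hconv m2 m3 (a := 1 - y / R) (b := y / R) (by linarith) q0 (by ring)
    convert this using 1
    ext
    · simp
      field_simp
      ring
    · simp
      field_simp
  have hW : 0 < s * R + y := by positivity
  have := hconv l rr (a := 1 - x / (s * R + y)) (b := x / (s * R + y))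
    (by rw [sub_nonneg, div_le_one hW]; exact hxy) (by positivity) (by ring)
  convert this using 1
  ext
  · simp
    field_simp
  · simp
    ring

end Helpers

open MeasureTheory in
/-- Let `r ≥ 2` and let `P` be a convex lattice polygon (the convex hull of a
finite subset of `ℤ²`) with positive area strictly less than `r²/2`.  Then
after a suitable lattice-preserving affine transformation `x ↦ Mx + t`
(`M ∈ GL(2, ℤ)`, `t ∈ ℤ²`), `P` is contained in the trapezoid `Ω` with
vertices `(0,0)`, `(√2·r², 0)`, `((√2+1)·r², r²)`, `(0, r²)`. -/
theorem lattice_polygon_in_trapezoid (r : ℕ) (hr : 2 ≤ r)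
    (S : Finset (ℤ × ℤ)) (P : Set (ℝ × ℝ))
    (hP : P = convexHull ℝ (emb '' (S : Set (ℤ × ℤ))))
    (hpos : 0 < volume P)
    (harea : volume P < ENNReal.ofReal ((r : ℝ) ^ 2 / 2)) :
    ∃ (M : Matrix (Fin 2) (Fin 2) ℤ) (t : ℤ × ℤ), IsUnit M.det ∧
      (fun x : ℝ × ℝ =>
          ((M 0 0 : ℝ) * x.1 + (M 0 1 : ℝ) * x.2 + (t.1 : ℝ),
           (M 1 0 : ℝ) * x.1 + (M 1 1 : ℝ) * x.2 + (t.2 : ℝ))) '' P ⊆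
        convexHull ℝ
          {((0 : ℝ), (0 : ℝ)), (Real.sqrt 2 * (r : ℝ) ^ 2, 0),
            ((Real.sqrt 2 + 1) * (r : ℝ) ^ 2, (r : ℝ) ^ 2), (0, (r : ℝ) ^ 2)} := by
  have hR : (0 : ℝ) < (r : ℝ) ^ 2 := by positivity
  have hc : Convex ℝ P := hP ▸ convex_convexHull ℝ _
  have hmem : ∀ z ∈ S, emb z ∈ P := fun z hz =>
    hP ▸ subset_convexHull ℝ _ (Set.mem_image_of_mem _ hz)
  obtain ⟨M, t, hM, h⟩ := integer_part S ((r : ℤ) ^ 2) (by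
    intro p hp q hq u hu v hv
    have := crs_bound hc (hmem p hp) (hmem q hq) (hmem u hu) (hmem v hv) hR harea
    simp only [crs, emb, Prod.fst_sub, Prod.snd_sub] at this
    exact_mod_cast this) (fun a b c hab => not_const S (hP ▸ hpos) a b c hab)
  refine ⟨M, t, hM, ?_⟩
  rw [Set.image_subset_iff, hP]
  apply convexHull_min
  · rintro _ ⟨z, hz, rfl⟩
    obtain ⟨h1, h2, h3, h4⟩ := h z hz
    have h1' : (0 : ℝ) ≤ M 0 0 * z.1 + M 0 1 * z.2 + t.1 := by exact_mod_cast h1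
    have h2' : (0 : ℝ) ≤ M 1 0 * z.1 + M 1 1 * z.2 + t.2 := by exact_mod_cast h2
    have h3' : (M 1 0 * z.1 + M 1 1 * z.2 + t.2 : ℝ) ≤ (r : ℝ) ^ 2 := by exact_mod_cast h3
    have h4' : (M 0 0 * z.1 + M 0 1 * z.2 + t.1 : ℝ)
        ≤ (r : ℝ) ^ 2 + (M 1 0 * z.1 + M 1 1 * z.2 + t.2) := by exact_mod_cast h4
    have hs : (1 : ℝ) ≤ Real.sqrt 2 := by
      rw [Real.one_le_sqrt]; norm_num
    have h5 : (r : ℝ) ^ 2 ≤ Real.sqrt 2 * (r : ℝ) ^ 2 := le_mul_of_one_le_left hR.le hs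
    exact mem_trap _ _ _ _ hR (by linarith) h1' h2' h3' (h4'.trans (add_le_add_left h5 _))
  · intro x hx y hy a b ha hb hab
    have := convex_convexHull ℝ _ hx hy ha hb hab
    rw [Set.mem_preimage]
    convert this using 1
    have : b = 1 - a := by linarith
    subst this
    ext
    · simp
      ring
    · simp
      ring
end
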